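/- arXiv:1911.01792 — 6 statements merged into one kernel-verified Lean document; each statement's English description precedes it below -/
import Mathlib

section
/- Let n ≥ 2 and let p₀, p₁, …, pₙ be points of ℝⁿ whose convex hull Δ (an n-simplex) has positive n-dimensional Lebesgue measure V(Δ). Then (∑_{i=0}^{n} ‖pᵢ‖)ⁿ ≥ n! · √((n+1)^(n−1) · nⁿ) · V(Δ). -/
open MeasureTheory

/-- The corner simplex of size `t` in `ℝⁿ` has volume at most `tⁿ / n!`. -/
theorem volume_cornerSimplex_le (n : ℕ) (t : ℝ) (ht : 0 ≤ t) :
    volume {x : Fin n → ℝ | (∀ i, 0 ≤ x i) ∧ ∑ i, x i ≤ t} ≤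
      ENNReal.ofReal (t ^ n / n.factorial) := by
  induction n generalizing t with
  | zero =>
    refine (measure_mono (Set.subset_univ _)).trans ?_
    simp [volume_pi]
  | succ n ih =>
    set T : Set (ℝ × (Fin n → ℝ)) :=
      {z | 0 ≤ z.1 ∧ (∀ i, 0 ≤ z.2 i) ∧ z.1 + ∑ i, z.2 i ≤ t} with hT
    have hTc : IsClosed T := by
      simp only [hT, Set.ofPred_and, Set.ofPred_forall]
      refine (isClosed_le (by fun_prop) (by fun_prop)).inter
        (IsClosed.inter ?_ (isClosed_le (by fun_prop) (by fun_prop)))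
      exact isClosed_iInter fun i => isClosed_le (by fun_prop) (by fun_prop)
    have hpre : {x : Fin (n + 1) → ℝ | (∀ i, 0 ≤ x i) ∧ ∑ i, x i ≤ t} =
        MeasurableEquiv.piFinSuccAbove (fun _ => ℝ) 0 ⁻¹' T := by
      ext x
      simp [hT, Fin.forall_fin_succ, Fin.sum_univ_succ, Fin.tail, and_assoc]
    rw [hpre, (volume_preserving_piFinSuccAbove (fun _ => ℝ) 0).measure_preimage
      hTc.measurableSet.nullMeasurableSet, Measure.volume_eq_prod,
      Measure.prod_apply hTc.measurableSet]
    have hslice : ∀ a : ℝ, volume (Prod.mk a ⁻¹' T) ≤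
        (Set.Icc 0 t).indicator (fun a => ENNReal.ofReal ((t - a) ^ n / n.factorial)) a := by
      intro a
      by_cases ha : a ∈ Set.Icc 0 t
      · rw [Set.indicator_of_mem ha]
        refine (measure_mono ?_).trans (ih (t - a) (sub_nonneg.2 ha.2))
        rintro y ⟨-, hy, hy'⟩
        exact ⟨hy, by simp only at hy'; linarith⟩
      · have : Prod.mk a ⁻¹' T = ∅ := by
          refine Set.eq_empty_of_forall_notMem ?_
          rintro y ⟨h0, hy, hy'⟩
          have := Finset.sum_nonneg fun i (_ : i ∈ Finset.univ) => hy i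
          exact ha ⟨h0, by simp only at hy' this; linarith⟩
        simp [this]
    refine (lintegral_mono hslice).trans ?_
    rw [lintegral_indicator measurableSet_Icc, ← ofReal_integral_eq_lintegral_ofReal,
      integral_Icc_eq_integral_Ioc, ← intervalIntegral.integral_of_le ht]
    · refine ENNReal.ofReal_le_ofReal (le_of_eq ?_)
      rw [intervalIntegral.integral_div,
        intervalIntegral.integral_comp_sub_left (fun x : ℝ => x ^ n) t, integral_pow,
        Nat.factorial_succ]
      push_cast
      field_simp
      simp
    · exact (Continuous.integrableOn_Icc (by fun_prop))
    · filter_upwards [self_mem_ae_restrict measurableSet_Icc] with a ha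
      have := sub_nonneg.2 ha.2
      simp only [Pi.zero_apply]
      positivity

/-- The volume of a simplex is at most the usual determinant divided by `n!`. -/
theorem volume_convexHull_le (n : ℕ) (p : Fin (n + 1) → EuclideanSpace ℝ (Fin n)) :
    volume (convexHull ℝ (Set.range p)) ≤
      ENNReal.ofReal (|(Matrix.of fun i j : Fin n => p i.succ j - p 0 j).det| / n.factorial) := by
  set A : Matrix (Fin n) (Fin n) ℝ := Matrix.of fun i j => p i.succ j - p 0 j with hA
  set S : Set (Fin n → ℝ) := {x | (∀ i, 0 ≤ x i) ∧ ∑ i, x i ≤ 1} with hS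
  have hSconv : Convex ℝ S := by
    rintro x ⟨hx, hx'⟩ y ⟨hy, hy'⟩ a b ha hb hab
    refine ⟨fun i => add_nonneg (mul_nonneg ha (hx i)) (mul_nonneg hb (hy i)), ?_⟩
    simp only [Pi.add_apply, Pi.smul_apply, smul_eq_mul, Finset.sum_add_distrib,
      ← Finset.mul_sum]
    nlinarith
  have hA' : ∀ i : Fin n, Matrix.toLin' A.transpose (Pi.single i 1) =
      fun j => p i.succ j - p 0 j := by
    intro i
    ext j
    simp [hA]
  have hsub : convexHull ℝ (Set.range p) ⊆ WithLp.ofLp ⁻¹'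
      ((fun x => WithLp.ofLp (p 0) + x) '' (Matrix.toLin' A.transpose '' S)) := by
    refine convexHull_min ?_ ?_
    · rintro _ ⟨i, rfl⟩
      refine Fin.cases ?_ (fun i => ?_) i
      · exact ⟨0, ⟨0, ⟨fun _ => le_rfl, by simp⟩, map_zero _⟩, add_zero _⟩
      · refine ⟨_, ⟨Pi.single i 1, ⟨fun j => ?_, by simp⟩, hA' i⟩, ?_⟩
        · by_cases h : j = i
          · subst h; simp
          · simp [h]
        · ext j; simp
    · exact ((hSconv.linear_image _).translate _).linear_preimage
        (WithLp.linearEquiv 2 ℝ (Fin n → ℝ)).toLinearMap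
  have hSm : volume S ≤ ENNReal.ofReal (1 / n.factorial) := by
    simpa using volume_cornerSimplex_le n 1 zero_le_one
  refine (measure_mono hsub).trans ?_
  have hpres : MeasurePreserving (MeasurableEquiv.toLp 2 (Fin n → ℝ)).symm :=
    PiLp.volume_preserving_ofLp (Fin n)
  refine (hpres.measure_preimage_equiv _).trans_le ?_
  rw [Set.image_add_left, measure_preimage_add, Measure.addHaar_image_linearMap,
    LinearMap.det_toLin', Matrix.det_transpose, div_eq_mul_one_div,
    ENNReal.ofReal_mul (abs_nonneg _)]
  gcongr

theorem prod_le_sum_div_card_pow {n : ℕ} (hn : 0 < n) (z : Fin n → ℝ) (hz : ∀ i, 0 ≤ z i) :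
    ∏ i, z i ≤ ((∑ i, z i) / n) ^ n := by
  have h := Real.geom_mean_le_arith_mean_weighted Finset.univ (fun _ => (n : ℝ)⁻¹) z
    (fun _ _ => by positivity) (by simp [hn.ne']) fun i _ => hz i
  rw [← Finset.mul_sum, Real.finsetProd_rpow _ _ fun i _ => hz i] at h
  have hp : 0 ≤ ∏ i, z i := Finset.prod_nonneg fun i _ => hz i
  calc ∏ i, z i = ((∏ i, z i) ^ (n : ℝ)⁻¹) ^ n := (Real.rpow_inv_natCast_pow hp hn.ne').symm
    _ ≤ ((n : ℝ)⁻¹ * ∑ i, z i) ^ n := by gcongr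
    _ = _ := by rw [div_eq_inv_mul]

/-- Maclaurin's inequality for the elementary symmetric function of degree `n` in `n + 1`
positive variables. -/
theorem prod_mul_sum_inv_le (n : ℕ) (s : Fin (n + 1) → ℝ) (hs : ∀ i, 0 < s i) :
    (∏ i, s i) * ∑ i, (s i)⁻¹ ≤ (n + 1) * ((∑ i, s i) / (n + 1)) ^ n := by
  induction n with
  | zero => simp [(hs 0).ne']
  | succ n ih =>
    rw [Fin.prod_univ_succ, Fin.sum_univ_succ s, Fin.sum_univ_succ fun i => (s i)⁻¹]
    have hih := ih (fun i => s i.succ) fun i => hs _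
    have hamgm := prod_le_sum_div_card_pow n.succ_pos (fun i => s i.succ) fun i => (hs _).le
    have hx := hs 0
    have hS : 0 < ∑ i : Fin (n + 1), s i.succ :=
      Finset.sum_pos (fun i _ => hs _) Finset.univ_nonempty
    set P := ∏ i : Fin (n + 1), s i.succ
    set H := ∑ i : Fin (n + 1), (s i.succ)⁻¹
    set x := s 0
    push_cast at hamgm ⊢
    set m := (∑ i : Fin (n + 1), s i.succ) / ((n : ℝ) + 1) with hm
    have hmpos : 0 < m := by positivity
    have hsum : ∑ i : Fin (n + 1), s i.succ = (n + 1) * m := by rw [hm]; field_simp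
    rw [hsum]
    set μ := (x + (n + 1) * m) / ((n : ℝ) + 1 + 1) with hμ
    have hμpos : 0 < μ := by positivity
    have hxμ : x = (n + 2) * μ - (n + 1) * m := by rw [hμ]; field_simp; ring
    have hbern : (n + 1) * μ * m ^ n - n * m ^ (n + 1) ≤ μ ^ (n + 1) := by
      clear_value m
      have hratio : 0 < μ / m := by positivity
      have hb := one_add_mul_le_pow (a := μ / m - 1) (by linarith) (n + 1)
      have hmn : 0 < m ^ (n + 1) := by positivity
      have hb' := mul_le_mul_of_nonneg_right hb hmn.le
      rw [add_sub_cancel, div_pow μ m, div_mul_cancel₀ _ hmn.ne'] at hb'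
      refine le_trans (le_of_eq ?_) hb'
      push_cast
      field_simp
      ring
    calc x * P * (x⁻¹ + H) = P + x * (P * H) := by field_simp
      _ ≤ m ^ (n + 1) + x * ((n + 1) * m ^ n) := by gcongr
      _ = (n + 2) * ((n + 1) * μ * m ^ n - n * m ^ (n + 1)) := by rw [hxμ]; ring
      _ ≤ (n + 2) * μ ^ (n + 1) := by gcongr
      _ = _ := by ring

theorem Matrix.PosSemidef.det_le_trace_div_pow {n : ℕ} (hn : 0 < n)
    {A : Matrix (Fin n) (Fin n) ℝ} (hA : A.PosSemidef) : A.det ≤ (A.trace / n) ^ n := by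
  rw [hA.isHermitian.det_eq_prod_eigenvalues, hA.isHermitian.trace_eq_sum_eigenvalues]
  exact prod_le_sum_div_card_pow hn _ hA.eigenvalues_nonneg

theorem det_cons_eq (n : ℕ) (t : ℝ) (q : Fin (n + 1) → Fin n → ℝ) :
    (Matrix.of fun i => (Fin.cons t (q i) : Fin (n + 1) → ℝ)).det =
      t * (Matrix.of fun i j : Fin n => q i.succ j - q 0 j).det := by
  rw [Matrix.det_eq_of_forall_row_eq_smul_add_const
    (B := Matrix.of (Fin.cons (Fin.cons t (q 0))
      fun i => (Fin.cons 0 fun j => q i.succ j - q 0 j : Fin (n + 1) → ℝ)))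
    (Fin.cons 0 fun _ => 1) 0 rfl, Matrix.det_succ_column_zero, Fin.sum_univ_succ]
  · simp
    left
    rfl
  · intro i j
    refine Fin.cases ?_ (fun i => ?_) i <;> refine Fin.cases ?_ (fun j => ?_) j <;> simp

/-- A weighted Hadamard-type bound, with positive weights `s i` dominating the norms. -/
theorem det_sq_le_of_norm_le {n : ℕ} (hn : 0 < n) (p : Fin (n + 1) → EuclideanSpace ℝ (Fin n))
    (s : Fin (n + 1) → ℝ) (hs : ∀ i, 0 < s i) (hps : ∀ i, ‖p i‖ ≤ s i) :
    (Matrix.of fun i j : Fin n => p i.succ j - p 0 j).det ^ 2 ≤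
      (∏ i, s i) * (∑ i, (s i)⁻¹) * ((∑ i, s i) / n) ^ n := by
  set D := (Matrix.of fun i j : Fin n => p i.succ j - p 0 j).det
  set H := ∑ i, (s i)⁻¹
  set S := ∑ i, s i
  have hH : 0 < H := Finset.sum_pos (fun i _ => inv_pos.2 (hs i)) Finset.univ_nonempty
  have hS : 0 < S := Finset.sum_pos (fun i _ => hs i) Finset.univ_nonempty
  have hn' : (0 : ℝ) < n := by exact_mod_cast hn
  set t := √(S / (n * H))
  have ht : t ^ 2 = S / (n * H) := Real.sq_sqrt (by positivity)
  set M : Matrix (Fin (n + 1)) (Fin (n + 1)) ℝ :=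
    Matrix.of fun i => (Fin.cons t (p i) : Fin (n + 1) → ℝ) with hM
  set W : Matrix (Fin (n + 1)) (Fin (n + 1)) ℝ := Matrix.diagonal fun i => (s i)⁻¹
  have hW : W.PosSemidef := Matrix.PosSemidef.diagonal fun i => (inv_pos.2 (hs i)).le
  have hG := hW.conjTranspose_mul_mul_same M
  have hdet : (M.conjTranspose * W * M).det = t ^ 2 * D ^ 2 * (∏ i, s i)⁻¹ := by
    rw [Matrix.det_mul, Matrix.det_mul, Matrix.conjTranspose_eq_transpose_of_trivial,
      Matrix.det_transpose, Matrix.det_diagonal, hM, det_cons_eq, Finset.prod_inv_distrib]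
    ring
  have htrace : (M.conjTranspose * W * M).trace ≤ S * (n + 1) / n := by
    have h1 : (M.conjTranspose * W * M).trace = ∑ i, (s i)⁻¹ * (t ^ 2 + ‖p i‖ ^ 2) := by
      rw [Matrix.mul_assoc, Matrix.trace_mul_comm, Matrix.trace]
      refine Finset.sum_congr rfl fun i _ => ?_
      rw [Matrix.diag_apply, Matrix.mul_assoc, Matrix.diagonal_mul, Matrix.mul_apply,
        Fin.sum_univ_succ, EuclideanSpace.real_norm_sq_eq]
      simp [hM, sq]
    rw [h1]
    calc ∑ i, (s i)⁻¹ * (t ^ 2 + ‖p i‖ ^ 2) ≤ ∑ i, ((s i)⁻¹ * t ^ 2 + s i) := by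
          refine Finset.sum_le_sum fun i _ => ?_
          rw [mul_add]
          gcongr
          rw [inv_mul_le_iff₀ (hs i), ← sq]
          gcongr
          exact hps i
      _ = H * t ^ 2 + S := by rw [Finset.sum_add_distrib, ← Finset.sum_mul]
      _ = S * (n + 1) / n := by rw [ht]; field_simp; ring
  have htrace0 : 0 ≤ (M.conjTranspose * W * M).trace := hG.trace_nonneg
  have hle : t ^ 2 * D ^ 2 * (∏ i, s i)⁻¹ ≤ (S / n) ^ (n + 1) := by
    rw [← hdet]
    refine (hG.det_le_trace_div_pow n.succ_pos).trans ?_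
    refine pow_le_pow_left₀ (by positivity) ?_ _
    rw [div_le_iff₀ (by positivity)]
    refine htrace.trans (le_of_eq ?_)
    push_cast
    ring
  have hP : 0 < ∏ i, s i := Finset.prod_pos fun i _ => hs i
  rw [ht] at hle
  have hc : 0 < n * H / S * ∏ i, s i := by positivity
  calc D ^ 2 = (n * H / S * ∏ i, s i) * (S / (n * H) * D ^ 2 * (∏ i, s i)⁻¹) := by
        field_simp
    _ ≤ (n * H / S * ∏ i, s i) * (S / n) ^ (n + 1) := by gcongr
    _ = _ := by rw [pow_succ]; field_simp

theorem mul_det_sq_le {n : ℕ} (hn : 0 < n) (p : Fin (n + 1) → EuclideanSpace ℝ (Fin n)) :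
    ((n : ℝ) + 1) ^ (n - 1) * (n : ℝ) ^ n *
      (Matrix.of fun i j : Fin n => p i.succ j - p 0 j).det ^ 2 ≤ ((∑ i, ‖p i‖) ^ n) ^ 2 := by
  have hn' : (0 : ℝ) < n := by exact_mod_cast hn
  have key : ∀ ε : ℝ, 0 < ε → ((n : ℝ) + 1) ^ (n - 1) * (n : ℝ) ^ n *
      (Matrix.of fun i j : Fin n => p i.succ j - p 0 j).det ^ 2 ≤
        ((∑ i, (‖p i‖ + ε)) ^ n) ^ 2 := by
    intro ε hε
    have hs : ∀ i, 0 < ‖p i‖ + ε := fun i => by positivity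
    have hS : 0 ≤ ∑ i, (‖p i‖ + ε) := Finset.sum_nonneg fun i _ => (hs i).le
    have h1 := det_sq_le_of_norm_le hn p _ hs fun i => by linarith
    have h2 := prod_mul_sum_inv_le n _ hs
    set S := ∑ i, (‖p i‖ + ε)
    calc _ ≤ ((n : ℝ) + 1) ^ (n - 1) * (n : ℝ) ^ n *
          ((n + 1) * (S / (n + 1)) ^ n * (S / n) ^ n) := by
          gcongr
          exact h1.trans (by gcongr)
      _ = (((n : ℝ) + 1) ^ (n - 1) * (n + 1)) * (n : ℝ) ^ n *
          ((S / (n + 1)) ^ n * (S / n) ^ n) := by ring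
      _ = _ := by
          rw [← pow_succ, Nat.sub_add_cancel hn, div_pow, div_pow]
          field_simp
  have hlim : Filter.Tendsto (fun ε : ℝ => ((∑ i, (‖p i‖ + ε)) ^ n) ^ 2)
      (nhdsWithin 0 (Set.Ioi 0)) (nhds (((∑ i, ‖p i‖) ^ n) ^ 2)) := by
    have hc : Continuous fun ε : ℝ => ((∑ i, (‖p i‖ + ε)) ^ n) ^ 2 := by fun_prop
    simpa using (hc.tendsto 0).mono_left nhdsWithin_le_nhds
  exact ge_of_tendsto hlim (Filter.eventually_of_mem self_mem_nhdsWithin key)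


theorem simplex_length_estimate (n : ℕ) (hn : 2 ≤ n)
    (p : Fin (n + 1) → EuclideanSpace ℝ (Fin n))
    (hV : 0 < volume (convexHull ℝ (Set.range p))) :
    (∑ i, ‖p i‖) ^ n ≥
      (n.factorial : ℝ) * Real.sqrt (((n : ℝ) + 1) ^ (n - 1) * (n : ℝ) ^ n) *
        (volume (convexHull ℝ (Set.range p))).toReal := by
  set D := (Matrix.of fun i j : Fin n => p i.succ j - p 0 j).det with hD
  have hvol : (n.factorial : ℝ) * (volume (convexHull ℝ (Set.range p))).toReal ≤ |D| := by
    have h := ENNReal.toReal_le_of_le_ofReal (by positivity) (volume_convexHull_le n p)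
    rwa [le_div_iff₀ (by positivity), mul_comm] at h
  set K : ℝ := ((n : ℝ) + 1) ^ (n - 1) * (n : ℝ) ^ n with hK
  have hdet : √K * |D| ≤ (∑ i, ‖p i‖) ^ n := by
    refine le_of_sq_le_sq ?_ (by positivity)
    rw [mul_pow, Real.sq_sqrt (by positivity), sq_abs]
    exact mul_det_sq_le (by omega) p
  calc _ = √K * (n.factorial * (volume (convexHull ℝ (Set.range p))).toReal) := by ring
    _ ≤ √K * |D| := by gcongr
    _ ≤ _ := hdet
end

section
/- Let n ≥ 2 and m ≥ n be integers and let g₁, …, g_m be vectors in ℝⁿ such that ‖g₁‖ ≤ ‖gᵢ‖ for every i = 1, …, m. Then (m − n + 1) · nⁿ · |det(g₁, …, gₙ)| ≤ (∑_{i=1}^{m} ‖gᵢ‖)ⁿ, where det(g₁, …, gₙ) denotes the determinant of the n × n matrix whose columns are g₁, …, gₙ. -/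
/-- **Hadamard's inequality**: the absolute value of a determinant is at most the product of the
Euclidean norms of the columns. -/
theorem abs_det_le_prod_norm {n : ℕ} (v : Fin n → EuclideanSpace ℝ (Fin n)) :
    |(Matrix.of fun i j : Fin n => v j i).det| ≤ ∏ j, ‖v j‖ := by
  have : Fact (Module.finrank ℝ (EuclideanSpace ℝ (Fin n)) = n) := ⟨finrank_euclideanSpace_fin⟩
  let b := EuclideanSpace.basisFun (Fin n) ℝ
  have h := b.toBasis.orientation.abs_volumeForm_apply_le v
  rw [Orientation.volumeForm_robust _ b rfl, Module.Basis.det_apply] at h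
  exact h

/-- The AM-GM inequality for `n` nonnegative reals, without roots. -/
theorem card_pow_mul_prod_le_sum_pow {n : ℕ} (c : Fin n → ℝ) (hc : ∀ i, 0 ≤ c i) :
    (n : ℝ) ^ n * ∏ i, c i ≤ (∑ i, c i) ^ n := by
  rcases Nat.eq_zero_or_pos n with rfl | hn
  · simp
  have hn' : (0 : ℝ) < n := Nat.cast_pos.2 hn
  have h := Real.geom_mean_le_arith_mean Finset.univ (fun _ => (1 : ℝ)) c
    (fun _ _ => zero_le_one) (by simpa using hn) (fun i _ => hc i)
  simp only [Real.rpow_one, Finset.sum_const, Finset.card_univ, Fintype.card_fin, nsmul_eq_mul,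
    mul_one, one_mul] at h
  have hp : 0 ≤ ∏ i, c i := Finset.prod_nonneg fun i _ => hc i
  have h' := pow_le_pow_left₀ (Real.rpow_nonneg hp _) h n
  rw [Real.rpow_inv_natCast_pow hp hn.ne', div_pow, le_div_iff₀ (pow_pos hn' n)] at h'
  linarith

theorem bouquet_length_estimate (n m : ℕ) (hn : 2 ≤ n) (hm : n ≤ m)
    (g : Fin m → EuclideanSpace ℝ (Fin n))
    (hmin : ∀ i, ‖g ⟨0, by omega⟩‖ ≤ ‖g i‖) :
    ((m - n + 1 : ℕ) : ℝ) * (n : ℝ) ^ n *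
        |(Matrix.of fun i j : Fin n => g (Fin.castLE hm j) i).det| ≤
      (∑ i, ‖g i‖) ^ n := by
  obtain ⟨k, rfl⟩ := Nat.exists_eq_add_of_le hm
  obtain ⟨p, rfl⟩ : ∃ p, n = p + 1 := ⟨n - 1, by omega⟩
  have hdet := abs_det_le_prod_norm fun j : Fin (p + 1) => g (Fin.castLE hm j)
  let b : Fin (p + 1) → ℝ := fun j => ‖g (Fin.castLE hm j)‖
  -- Lump the `k` surplus vectors together with the shortest one.
  let c : Fin (p + 1) → ℝ := Fin.cons ((k + 1) * b 0) fun j => b j.succ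
  have hc : ∀ j, 0 ≤ c j := by
    refine Fin.cases ?_ fun j => ?_
    · simp only [c, b, Fin.cons_zero]; positivity
    · simp only [c, b, Fin.cons_succ]; positivity
  have hprod : ∏ j, c j = (k + 1) * ∏ j, b j := by
    simp only [c, Fin.prod_univ_succ, Fin.cons_zero, Fin.cons_succ, mul_assoc]
  have hsum : ∑ j, c j ≤ ∑ i, ‖g i‖ := by
    have hsurplus : (k : ℝ) * b 0 ≤ ∑ i : Fin k, ‖g (Fin.natAdd (p + 1) i)‖ := by
      simpa using Finset.card_nsmul_le_sum Finset.univ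
        (fun i : Fin k => ‖g (Fin.natAdd (p + 1) i)‖) (b 0) fun i _ => hmin _
    have hsplit : ∑ i, ‖g i‖ = ∑ j, b j + ∑ i : Fin k, ‖g (Fin.natAdd (p + 1) i)‖ :=
      Fin.sum_univ_add _
    rw [hsplit, Fin.sum_univ_succ, Fin.sum_univ_succ b]
    simp only [c, Fin.cons_zero, Fin.cons_succ]
    linarith
  have hcast : ((p + 1 + k - (p + 1) + 1 : ℕ) : ℝ) = k + 1 := by
    rw [Nat.add_sub_cancel_left]; push_cast; rfl
  rw [hcast]
  calc _ ≤ ((k : ℝ) + 1) * ((p + 1 : ℕ) : ℝ) ^ (p + 1) * ∏ j, b j := by gcongr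
    _ = ((p + 1 : ℕ) : ℝ) ^ (p + 1) * ∏ j, c j := by rw [hprod]; ring
    _ ≤ (∑ j, c j) ^ (p + 1) := card_pow_mul_prod_le_sum_pow c hc
    _ ≤ _ := pow_le_pow_left₀ (Finset.sum_nonneg fun j _ => hc j) hsum _
end

section
/- Let p₁, p₂, p₃, q₁, q₂ be points of ℝ³. Then |det(p₂ − p₁, q₂ − q₁, p₃ − p₁)| ≤ (1/27) · (‖p₂ − p₁‖ + ‖q₂ − q₁‖ + ‖p₃ − q₁‖ + ‖q₁ − p₁‖)³, where det(u, v, w) denotes the determinant of the 3 × 3 matrix with columns u, v, w. -/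
/-- Determinant of the 3×3 matrix with the given columns. -/
noncomputable def det3 (u v w : EuclideanSpace ℝ (Fin 3)) : ℝ :=
  (Matrix.of fun i j : Fin 3 => ![u, v, w] j i).det

/-- Hadamard's inequality in dimension three. -/
theorem abs_det3_le (u v w : EuclideanSpace ℝ (Fin 3)) :
    |det3 u v w| ≤ ‖u‖ * ‖v‖ * ‖w‖ := by
  apply abs_le_of_sq_le_sq _ (by positivity)
  have cauchy_schwarz (a b c x y z : ℝ) :
      (a * x + b * y + c * z) ^ 2 ≤ (a ^ 2 + b ^ 2 + c ^ 2) * (x ^ 2 + y ^ 2 + z ^ 2) := by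
    nlinarith [sq_nonneg (a * y - b * x), sq_nonneg (a * z - c * x), sq_nonneg (b * z - c * y)]
  have cross_le (a b c x y z : ℝ) :
      (b * z - c * y) ^ 2 + (c * x - a * z) ^ 2 + (a * y - b * x) ^ 2 ≤
        (a ^ 2 + b ^ 2 + c ^ 2) * (x ^ 2 + y ^ 2 + z ^ 2) := by
    nlinarith [sq_nonneg (a * x + b * y + c * z)]
  rw [mul_pow, mul_pow, EuclideanSpace.real_norm_sq_eq, EuclideanSpace.real_norm_sq_eq,
    EuclideanSpace.real_norm_sq_eq]
  simp only [Fin.sum_univ_three]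
  calc det3 u v w ^ 2
      = ((u 1 * v 2 - u 2 * v 1) * w 0 + (u 2 * v 0 - u 0 * v 2) * w 1
          + (u 0 * v 1 - u 1 * v 0) * w 2) ^ 2 := by
        simp [det3, Matrix.det_fin_three]
        ring
    _ ≤ _ := cauchy_schwarz _ _ _ _ _ _
    _ ≤ _ := mul_le_mul_of_nonneg_right (cross_le _ _ _ _ _ _) (by positivity)

/-- The inequality of arithmetic and geometric means for three reals. -/
theorem mul_mul_le_add_add_pow_three {a b c : ℝ} (ha : 0 ≤ a) (hb : 0 ≤ b) (hc : 0 ≤ c) :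
    a * b * c ≤ (1 / 27) * (a + b + c) ^ 3 := by
  nlinarith [mul_nonneg ha (sq_nonneg (b - c)), mul_nonneg hb (sq_nonneg (a - c)),
    mul_nonneg hc (sq_nonneg (a - b)), mul_nonneg ha (sq_nonneg (a - b)),
    mul_nonneg ha (sq_nonneg (a - c)), mul_nonneg hb (sq_nonneg (a - b)),
    mul_nonneg hb (sq_nonneg (b - c)), mul_nonneg hc (sq_nonneg (a - c)),
    mul_nonneg hc (sq_nonneg (b - c))]

theorem cds_length_estimate (p₁ p₂ p₃ q₁ q₂ : EuclideanSpace ℝ (Fin 3)) :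
    |det3 (p₂ - p₁) (q₂ - q₁) (p₃ - p₁)| ≤
      (1 / 27) * (‖p₂ - p₁‖ + ‖q₂ - q₁‖ + ‖p₃ - q₁‖ + ‖q₁ - p₁‖) ^ 3 := by
  have triangle : ‖p₃ - p₁‖ ≤ ‖p₃ - q₁‖ + ‖q₁ - p₁‖ := norm_sub_le_norm_sub_add_norm_sub _ _ _
  calc |det3 (p₂ - p₁) (q₂ - q₁) (p₃ - p₁)|
      ≤ ‖p₂ - p₁‖ * ‖q₂ - q₁‖ * ‖p₃ - p₁‖ := abs_det3_le _ _ _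
    _ ≤ (1 / 27) * (‖p₂ - p₁‖ + ‖q₂ - q₁‖ + ‖p₃ - p₁‖) ^ 3 :=
        mul_mul_le_add_add_pow_three (norm_nonneg _) (norm_nonneg _) (norm_nonneg _)
    _ ≤ (1 / 27) * (‖p₂ - p₁‖ + ‖q₂ - q₁‖ + ‖p₃ - q₁‖ + ‖q₁ - p₁‖) ^ 3 := by
        rw [add_assoc _ ‖p₃ - q₁‖]
        gcongr
end

section
/- Let p₁, p₂, p₃ and q be points of ℝ³. Then the area of the triangle with vertices p₁, p₂, p₃, namely A = ‖(p₂ − p₁) × (p₃ − p₁)‖ / 2, satisfies A ≤ (1/√3) · ((‖p₁ − q‖ + ‖p₂ − q‖ + ‖p₃ − q‖)/2)². -/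
/-- The cross product on `ℝ³` with the Euclidean norm. -/
noncomputable def cross3 (u v : EuclideanSpace ℝ (Fin 3)) : EuclideanSpace ℝ (Fin 3) :=
  (EuclideanSpace.equiv (Fin 3) ℝ).symm
    (crossProduct (EuclideanSpace.equiv (Fin 3) ℝ u) (EuclideanSpace.equiv (Fin 3) ℝ v))

theorem norm_cross3_sq (u v : EuclideanSpace ℝ (Fin 3)) :
    ‖cross3 u v‖ ^ 2 = ‖u‖ ^ 2 * ‖v‖ ^ 2 - inner ℝ u v ^ 2 := by
  simp only [EuclideanSpace.real_norm_sq_eq, PiLp.inner_apply, Fin.sum_univ_three, cross3]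
  simp [cross_apply]
  ring

theorem cross3_sub_sub (u v w : EuclideanSpace ℝ (Fin 3)) :
    cross3 (v - u) (w - u) = cross3 u v + cross3 v w + cross3 w u := by
  ext i
  fin_cases i <;> simp [cross3, cross_apply] <;> ring

theorem sqrt_three_mul_norm_cross3_le (u v : EuclideanSpace ℝ (Fin 3)) :
    √3 * ‖cross3 u v‖ ≤ 2 * (‖u‖ * ‖v‖) + inner ℝ u v := by
  have hinner := neg_le_of_abs_le (abs_real_inner_le_norm u v)
  have hnonneg : 0 ≤ ‖u‖ * ‖v‖ := by positivity
  refine le_of_sq_le_sq ?_ (by linarith)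
  rw [mul_pow, Real.sq_sqrt (by norm_num), norm_cross3_sq]
  nlinarith [sq_nonneg (‖u‖ * ‖v‖ + 2 * inner ℝ u v)]

/-- Weitzenböck's inequality, in terms of two edge vectors of the triangle. -/
theorem weitzenboeck_cross3 (a b : EuclideanSpace ℝ (Fin 3)) :
    √3 * ‖cross3 a b‖ ≤ ‖a‖ ^ 2 + ‖b‖ ^ 2 - inner ℝ a b := by
  have hinner := real_inner_le_norm a b
  refine le_of_sq_le_sq ?_ (by nlinarith [sq_nonneg (‖a‖ - ‖b‖), sq_nonneg (‖a‖ + ‖b‖)])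
  rw [mul_pow, Real.sq_sqrt (by norm_num), norm_cross3_sq]
  nlinarith [sq_nonneg ((‖a‖ ^ 2 + ‖b‖ ^ 2) / 2 - 2 * inner ℝ a b),
    sq_nonneg (‖a‖ ^ 2 - ‖b‖ ^ 2)]

theorem two_mul_sqrt_three_mul_norm_cross3_sub_le (u v w : EuclideanSpace ℝ (Fin 3)) :
    2 * √3 * ‖cross3 (v - u) (w - u)‖ ≤ (‖u‖ + ‖v‖ + ‖w‖) ^ 2 := by
  have hweitz := weitzenboeck_cross3 (v - u) (w - u)
  rw [norm_sub_sq_real, norm_sub_sq_real, inner_sub_left, inner_sub_right, inner_sub_right,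
    real_inner_self_eq_norm_sq, real_inner_comm w u] at hweitz
  have htri : √3 * ‖cross3 (v - u) (w - u)‖ ≤
      √3 * (‖cross3 u v‖ + ‖cross3 v w‖ + ‖cross3 w u‖) := by
    rw [cross3_sub_sub]
    gcongr
    exact norm_add₃_le
  have hsymm := real_inner_comm u v
  have hsymm' := real_inner_comm u w
  linarith [sqrt_three_mul_norm_cross3_le u v, sqrt_three_mul_norm_cross3_le v w,
    sqrt_three_mul_norm_cross3_le w u]

theorem triangle_area_estimate (p₁ p₂ p₃ q : EuclideanSpace ℝ (Fin 3)) :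
    ‖cross3 (p₂ - p₁) (p₃ - p₁)‖ / 2 ≤
      (1 / Real.sqrt 3) * ((‖p₁ - q‖ + ‖p₂ - q‖ + ‖p₃ - q‖) / 2) ^ 2 := by
  have h := two_mul_sqrt_three_mul_norm_cross3_sub_le (p₁ - q) (p₂ - q) (p₃ - q)
  rw [sub_sub_sub_cancel_right, sub_sub_sub_cancel_right] at h
  rw [one_div_mul_eq_div, le_div_iff₀ (by positivity)]
  linarith
end

section
/- Let x₁, x₂, x₃, z be positive real numbers with z ≥ (√3/2)·(x₁ + x₂). Then (x₁ + x₂ + x₃ + z)² ≥ √3·(2 + √3)·(x₁x₂ + x₁x₃ + x₂x₃). Equality is attained, e.g. for x₁ = x₂, x₃ = (1+√3)·x₁ and z = √3·x₁. -/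
theorem horizontal_case_inequality (x₁ x₂ x₃ z : ℝ)
    (h₁ : 0 < x₁) (h₂ : 0 < x₂) (h₃ : 0 < x₃) (hz0 : 0 < z)
    (hz : z ≥ Real.sqrt 3 / 2 * (x₁ + x₂)) :
    (x₁ + x₂ + x₃ + z) ^ 2 ≥
        Real.sqrt 3 * (2 + Real.sqrt 3) * (x₁ * x₂ + x₁ * x₃ + x₂ * x₃) ∧
      (x₂ = x₁ → x₃ = (1 + Real.sqrt 3) * x₁ → z = Real.sqrt 3 * x₁ →
        (x₁ + x₂ + x₃ + z) ^ 2 =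
          Real.sqrt 3 * (2 + Real.sqrt 3) * (x₁ * x₂ + x₁ * x₃ + x₂ * x₃)) := by
  set s := Real.sqrt 3
  have hs : s ^ 2 = 3 := Real.sq_sqrt (by norm_num)
  have hs0 : 0 ≤ s := Real.sqrt_nonneg 3
  refine ⟨?_, ?_⟩
  · have hmono : (x₁ + x₂ + x₃ + s / 2 * (x₁ + x₂)) ^ 2 ≤ (x₁ + x₂ + x₃ + z) ^ 2 := by
      gcongr
    have hsos : (x₁ + x₂ + x₃ + s / 2 * (x₁ + x₂)) ^ 2 -
        s * (2 + s) * (x₁ * x₂ + x₁ * x₃ + x₂ * x₃) =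
        (x₃ - (1 + s) / 2 * (x₁ + x₂)) ^ 2 + s * (2 + s) / 4 * (x₁ - x₂) ^ 2 := by
      linear_combination (-(x₁ + x₂) ^ 2 / 4 - (x₁ + x₂) * x₃) * hs
    have hnonneg : 0 ≤ (x₃ - (1 + s) / 2 * (x₁ + x₂)) ^ 2 +
        s * (2 + s) / 4 * (x₁ - x₂) ^ 2 := by
      positivity
    linarith
  · rintro rfl rfl rfl
    linear_combination (-(2 * s + 3) * x₂ ^ 2) * hs
end

section
/- Let x₁, x₂, x₃, y, z be positive real numbers. Then (x₁x₂ + x₁x₃ + x₂x₃)·(y + z) ≤ (4/81)·(x₁ + x₂ + x₃ + y + z)³, with equality if and only if x₁ = x₂ = x₃ and 2(y + z) = 3x₁. -/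
/-- The deficit in the inequality, written as a sum of products that are nonnegative when
`x₁ + x₂ + x₃` and `t` are. -/
lemma bnn_core_deficit (x₁ x₂ x₃ t : ℝ) :
    (4 / 81) * (x₁ + x₂ + x₃ + t) ^ 3 - (x₁ * x₂ + x₁ * x₃ + x₂ * x₃) * t =
      (1 / 81) * ((4 * (x₁ + x₂ + x₃) + t) * (x₁ + x₂ + x₃ - 2 * t) ^ 2) +
        (1 / 6) * (t * (x₁ - x₂) ^ 2 + t * (x₁ - x₃) ^ 2 + t * (x₂ - x₃) ^ 2) := by
  ring

theorem bnn_core_inequality (x₁ x₂ x₃ y z : ℝ)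
    (h₁ : 0 < x₁) (h₂ : 0 < x₂) (h₃ : 0 < x₃) (hy : 0 < y) (hz : 0 < z) :
    (x₁ * x₂ + x₁ * x₃ + x₂ * x₃) * (y + z) ≤
        (4 / 81) * (x₁ + x₂ + x₃ + y + z) ^ 3 ∧
      ((x₁ * x₂ + x₁ * x₃ + x₂ * x₃) * (y + z) =
          (4 / 81) * (x₁ + x₂ + x₃ + y + z) ^ 3 ↔
        (x₁ = x₂ ∧ x₂ = x₃ ∧ 2 * (y + z) = 3 * x₁)) := by
  have ht : 0 < y + z := add_pos hy hz
  have hc : 0 < 4 * (x₁ + x₂ + x₃) + (y + z) := by positivity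
  have key := bnn_core_deficit x₁ x₂ x₃ (y + z)
  rw [← add_assoc (x₁ + x₂ + x₃) y z] at key
  have hS := mul_nonneg hc.le (sq_nonneg (x₁ + x₂ + x₃ - 2 * (y + z)))
  have h12 := mul_nonneg ht.le (sq_nonneg (x₁ - x₂))
  have h13 := mul_nonneg ht.le (sq_nonneg (x₁ - x₃))
  have h23 := mul_nonneg ht.le (sq_nonneg (x₂ - x₃))
  refine ⟨by linarith, fun h => ?_, ?_⟩
  · have eq_zero {c a : ℝ} (hc : 0 < c) (h : c * a ^ 2 = 0) : a = 0 := by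
      simpa [hc.ne'] using h
    have e12 := eq_zero ht (a := x₁ - x₂) (by linarith)
    have e23 := eq_zero ht (a := x₂ - x₃) (by linarith)
    have eS := eq_zero hc (a := x₁ + x₂ + x₃ - 2 * (y + z)) (by linarith)
    exact ⟨by linarith, by linarith, by linarith⟩
  · rintro ⟨rfl, rfl, h⟩
    have hz' : z = 3 / 2 * x₁ - y := by linarith
    subst hz'
    ring
end
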